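/- Let ω > 0, let z ∈ ℬ_ω^{ij} for some i, j ∈ {0,1}, let ρ, σ ≤ ω/2 with ρ, σ > 0, let φ_σ = φ̂_σ and φ_ρ = φ̂_ρ be hat kernels, set f_σ = φ̂_σ * z, and define f(ρ,σ) = (1/ρ²)(−σ³ + 5ρσ² + 10ρ³) if σ ≤ ρ, and f(ρ,σ) = (1/σ²)(−ρ³ + 5σρ² + 10σ³) if ρ ≤ σ. Assume λ > 0 satisfies 2/λ + (1/15)(7ρ + f(ρ,σ)) < ω. If u ∈ ℬ^{ij} is a minimiser of F₃(u) = ∫_ℝ|u′| + λ‖φ̂_ρ*u − f_σ‖²_{L²(ℝ)} over ℬ^{ij}, then ∫_ℝ|u′| ≥ ∫_ℝ|z′|. -/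

import Mathlib

open MeasureTheory Set

noncomputable section

/-- The total variation `∫_ℝ |u'|` of a function `u : ℝ → ℝ`. -/
def TV (u : ℝ → ℝ) : ENNReal := eVariationOn u Set.univ

/-- Convolution `(φ * u)(x) = ∫_ℝ φ(x − y) u(y) dy`. -/
def conv (φ u : ℝ → ℝ) : ℝ → ℝ := fun x => ∫ y : ℝ, φ (x - y) * u y

/-- Membership of `φ` in the kernel class `𝒦`, with parameter `σ` and profile `p`:
`φ(x) = p(|x|) χ_{[−σ,σ]}(x)` with `p ≥ 0` monotonically decreasing on `[0,σ]`
and `∫₀^σ p = 1/2`; in particular `φ ∈ L¹(ℝ)`. -/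
def IsKernelWith (φ : ℝ → ℝ) (p : ℝ → ℝ) (σ : ℝ) : Prop :=
  0 < σ ∧ Integrable φ ∧
    (∀ x ∈ Icc (0:ℝ) σ, 0 ≤ p x) ∧ AntitoneOn p (Icc (0:ℝ) σ) ∧
    (∫ x in (0:ℝ)..σ, p x) = 1 / 2 ∧
    ∀ x : ℝ, φ x = if |x| ≤ σ then p |x| else 0

/-- The hat kernel `φ̂_σ(x) = (1 − |x|/σ)/σ` for `|x| < σ`, `0` otherwise. -/
def hatKernel (σ : ℝ) : ℝ → ℝ := fun x => if |x| < σ then (1 - |x| / σ) / σ else 0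

/-- The dual norm `‖f‖_* = sup { |∫ f v| : v ∈ L¹(ℝ), ∫_ℝ |v'| ≤ 1 }`. -/
def starNorm (f : ℝ → ℝ) : ENNReal :=
  ⨆ (v : ℝ → ℝ) (_ : Integrable v ∧ TV v ≤ 1), ENNReal.ofReal |∫ x : ℝ, f x * v x|

/-- Structural description of a bar code: `n` bars with interface points
`t 0 < t 1 < ⋯ < t (2n−1)` inside `[0,1]`; the bars are the intervals
`[t (2k), t (2k+1)]`, `k < n`. -/
structure BarcodeRep where
  n : ℕ
  t : ℕ → ℝ
  mono : StrictMonoOn t (Set.Iio (2 * n))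
  left : n ≠ 0 → 0 ≤ t 0
  right : n ≠ 0 → t (2 * n - 1) ≤ 1

/-- The support of a bar code: the union of its (closed) bars. -/
def BarcodeRep.supp (B : BarcodeRep) : Set ℝ :=
  ⋃ k ∈ Finset.range B.n, Icc (B.t (2 * k)) (B.t (2 * k + 1))

/-- The bar code as a function: the characteristic function of the union of its bars. -/
def BarcodeRep.fn (B : BarcodeRep) : ℝ → ℝ := B.supp.indicator fun _ => (1:ℝ)

/-- `x` is an interface location (an endpoint of a bar) of the bar code `B`. -/
def BarcodeRep.IsInterface (B : BarcodeRep) (x : ℝ) : Prop := ∃ k < 2 * B.n, B.t k = x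

/-- All bars and all (maximal, nonempty) spaces in `[0,1]` of the bar code `B`
have width at least `ω`. -/
def BarcodeRep.MinWidth (B : BarcodeRep) (ω : ℝ) : Prop :=
  (∀ k < B.n, ω ≤ B.t (2 * k + 1) - B.t (2 * k)) ∧
  (∀ k, k + 1 < B.n → ω ≤ B.t (2 * k + 2) - B.t (2 * k + 1)) ∧
  (B.n ≠ 0 → 0 < B.t 0 → ω ≤ B.t 0) ∧
  (B.n ≠ 0 → B.t (2 * B.n - 1) < 1 → ω ≤ 1 - B.t (2 * B.n - 1))

/-- Membership in `ℬ`: `u` is (the standard representative of) a bar code. -/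
def IsBarcode (u : ℝ → ℝ) : Prop := ∃ B : BarcodeRep, u = B.fn

/-- Membership in `ℬ_ω`. -/
def IsBarcodeW (u : ℝ → ℝ) (ω : ℝ) : Prop := ∃ B : BarcodeRep, u = B.fn ∧ B.MinWidth ω

/-- Membership in `ℬ^{ij}`: `u = i` on `[0,x₁]` and `u = j` on `[x₂,1]` for some
`0 < x₁ ≤ x₂ < 1`. -/
def InBij (u : ℝ → ℝ) (i j : ℝ) : Prop :=
  ∃ x₁ x₂ : ℝ, 0 < x₁ ∧ x₁ ≤ x₂ ∧ x₂ < 1 ∧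
    (∀ x ∈ Icc (0:ℝ) x₁, u x = i) ∧ (∀ x ∈ Icc x₂ (1:ℝ), u x = j)

/-- The `L²` fidelity term `‖g − f‖²_{L²(ℝ)}`, valued in `[0,∞]`
(equal to `∞` if `g − f ∉ L²(ℝ)`). -/
def fidelity (g f : ℝ → ℝ) : ENNReal := ∫⁻ x : ℝ, ENNReal.ofReal ((g x - f x) ^ 2)

/-- The functional `F₁(u) = ∫_ℝ |u'| + λ ‖u − f‖²_{L²(ℝ)}`. -/
def F1 (lam : ℝ) (f u : ℝ → ℝ) : ENNReal := TV u + ENNReal.ofReal lam * fidelity u f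

/-- The (blind) deconvolution functional `F(u) = ∫_ℝ |u'| + λ ‖φ*u − f‖²_{L²(ℝ)}`
(this is `F₂` when `φ = φ_σ` and `F₃` when `φ = φ_ρ`). -/
def Fker (lam : ℝ) (φ f u : ℝ → ℝ) : ENNReal :=
  TV u + ENNReal.ofReal lam * fidelity (conv φ u) f


theorem TV_add_le (f g : ℝ → ℝ) : TV (fun x => f x + g x) ≤ TV f + TV g := by
  unfold TV
  refine iSup_le ?_
  rintro ⟨n, u, hu, us⟩
  calc _ ≤ ∑ i ∈ Finset.range n, (edist (f (u (i+1))) (f (u i)) + edist (g (u (i+1))) (g (u i))) :=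
        Finset.sum_le_sum fun i _ => edist_add_add_le _ _ _ _
    _ = _ := Finset.sum_add_distrib
    _ ≤ _ := add_le_add (eVariationOn.sum_le hu us) (eVariationOn.sum_le hu us)

theorem TV_neg (f : ℝ → ℝ) : TV (fun x => - f x) = TV f := by
  unfold TV eVariationOn
  simp only [edist_neg_neg]

theorem TV_sub_le (f g : ℝ → ℝ) : TV (fun x => f x - g x) ≤ TV f + TV g := by
  have := TV_add_le f (fun x => - g x)
  rw [TV_neg] at this
  simpa only [sub_eq_add_neg] using this

theorem TV_mono_le (f : ℝ → ℝ) (hf : Monotone f) (h0 : ∀ x, 0 ≤ f x) (h1 : ∀ x, f x ≤ 1) :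
    TV f ≤ 1 := by
  unfold TV
  refine iSup_le ?_
  rintro ⟨n, u, hu, us⟩
  have : ∀ i, edist (f (u (i+1))) (f (u i)) = ENNReal.ofReal (f (u (i+1)) - f (u i)) := by
    intro i
    rw [edist_dist, Real.dist_eq, abs_of_nonneg (sub_nonneg.2 (hf (hu (Nat.le_succ i))))]
  simp only [this]
  rw [← ENNReal.ofReal_sum_of_nonneg (fun i _ => sub_nonneg.2 (hf (hu (Nat.le_succ i)))),
    Finset.sum_range_sub (fun i => f (u i))]
  rw [← ENNReal.ofReal_one]
  apply ENNReal.ofReal_le_ofReal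
  linarith [h0 (u 0), h1 (u n)]

theorem mono_ind (S : Set ℝ) (hS : IsUpperSet S) : TV (S.indicator fun _ => (1:ℝ)) ≤ 1 := by
  refine TV_mono_le _ ?_ ?_ ?_
  · intro x y hxy
    by_cases hx : x ∈ S
    · simp [hx, hS hxy hx]
    · by_cases hy : y ∈ S <;> simp [hx, hy]
  · intro x; by_cases hx : x ∈ S <;> simp [hx]
  · intro x; by_cases hx : x ∈ S <;> simp [hx]

theorem TV_Icc (a b : ℝ) (h : a ≤ b) : TV ((Icc a b).indicator fun _ => (1:ℝ)) ≤ 2 := by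
  have e : ((Icc a b).indicator fun _ => (1:ℝ)) =
      fun x => (Ici a).indicator (fun _ => (1:ℝ)) x - (Ioi b).indicator (fun _ => (1:ℝ)) x := by
    ext x
    simp only [indicator, mem_Icc, mem_Ici, mem_Ioi]
    split_ifs <;> grind
  rw [e, ← one_add_one_eq_two]
  exact (TV_sub_le _ _).trans (add_le_add (mono_ind _ (isUpperSet_Ici a)) (mono_ind _ (isUpperSet_Ioi b)))

theorem TV_Ioo (a b : ℝ) (h : a < b) : TV ((Ioo a b).indicator fun _ => (1:ℝ)) ≤ 2 := by
  have e : ((Ioo a b).indicator fun _ => (1:ℝ)) =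
      fun x => (Ioi a).indicator (fun _ => (1:ℝ)) x - (Ici b).indicator (fun _ => (1:ℝ)) x := by
    ext x
    simp only [indicator, mem_Ioo, mem_Ici, mem_Ioi]
    split_ifs <;> grind
  rw [e, ← one_add_one_eq_two]
  exact (TV_sub_le _ _).trans (add_le_add (mono_ind _ (isUpperSet_Ioi a)) (mono_ind _ (isUpperSet_Ici b)))

theorem BarcodeRep.mem_supp (B : BarcodeRep) (x : ℝ) :
    x ∈ B.supp ↔ ∃ k < B.n, B.t (2*k) ≤ x ∧ x ≤ B.t (2*k+1) := by
  simp only [BarcodeRep.supp, Finset.mem_range, mem_iUnion, mem_Icc, exists_prop]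

theorem BarcodeRep.lt (B : BarcodeRep) {k l : ℕ} (h : k < l) (hl : l < 2 * B.n) : B.t k < B.t l :=
  B.mono (by simp; omega) (by simpa using hl) h

theorem BarcodeRep.le (B : BarcodeRep) {k l : ℕ} (h : k ≤ l) (hl : l < 2 * B.n) : B.t k ≤ B.t l := by
  rcases h.eq_or_lt with rfl | h
  · rfl
  · exact (B.lt h hl).le

theorem BarcodeRep.gap (B : BarcodeRep) (p : ℕ) (x : ℝ) (hp : p < B.n)
    (h1 : B.t (2*p+1) < x) (h2 : p + 1 < B.n → x < B.t (2*p+2)) : x ∉ B.supp := by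
  rw [B.mem_supp]
  rintro ⟨k, hk, ha, hb⟩
  by_cases h : k ≤ p
  · have := B.le (show 2*k+1 ≤ 2*p+1 by omega) (by omega)
    linarith
  · have := B.le (show 2*p+2 ≤ 2*k by omega) (by omega)
    have := h2 (by omega)
    linarith

theorem BarcodeRep.supp_sub (B : BarcodeRep) (x : ℝ) (hx : x ∈ B.supp) : 0 ≤ x ∧ x ≤ 1 := by
  rw [B.mem_supp] at hx
  obtain ⟨k, hk, ha, hb⟩ := hx
  have h1 := B.left (by omega)
  have h2 := B.right (by omega)
  have h3 := B.le (show 0 ≤ 2*k by omega) (by omega)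
  have h4 := B.le (show 2*k+1 ≤ 2*B.n-1 by omega) (by omega)
  constructor <;> linarith

theorem BarcodeRep.meas (B : BarcodeRep) : MeasurableSet B.supp := by
  unfold BarcodeRep.supp
  exact Finset.measurableSet_biUnion _ fun k _ => measurableSet_Icc

theorem BarcodeRep.TV_le (B : BarcodeRep) : TV B.fn ≤ 2 * B.n := by
  have key : ∀ m ≤ B.n, TV ((⋃ k ∈ Finset.range m, Icc (B.t (2 * k)) (B.t (2 * k + 1))).indicator
      fun _ => (1:ℝ)) ≤ 2 * m := by
    intro m
    induction m with
    | zero => 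
      intro _
      simp [TV, eVariationOn]
    | succ m ih =>
      intro hm
      have e : ((⋃ k ∈ Finset.range (m+1), Icc (B.t (2 * k)) (B.t (2 * k + 1))).indicator
          fun _ => (1:ℝ)) = fun x => (⋃ k ∈ Finset.range m, Icc (B.t (2 * k)) (B.t (2 * k + 1))).indicator
          (fun _ => (1:ℝ)) x + (Icc (B.t (2 * m)) (B.t (2 * m + 1))).indicator (fun _ => (1:ℝ)) x := by
        have hd : Disjoint (⋃ k ∈ Finset.range m, Icc (B.t (2 * k)) (B.t (2 * k + 1)))
            (Icc (B.t (2 * m)) (B.t (2 * m + 1))) := by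
          rw [Set.disjoint_left]
          intro x hx hx'
          simp only [Finset.mem_range, mem_iUnion, mem_Icc, exists_prop] at hx hx'
          obtain ⟨k, hk, ha, hb⟩ := hx
          have := B.lt (show 2*k+1 < 2*m by omega) (by omega)
          linarith
        rw [Finset.range_add_one, Finset.set_biUnion_insert, Set.union_comm]
        exact Set.indicator_union_of_disjoint hd _
      rw [e]
      refine (TV_add_le _ _).trans ?_
      push_cast
      rw [mul_add, mul_one]
      exact add_le_add (ih (by omega)) (TV_Icc _ _ (B.le (by omega) (by omega)))
  exact key B.n le_rfl

theorem BarcodeRep.fn_one (B : BarcodeRep) {x : ℝ} : B.fn x = 1 ↔ x ∈ B.supp := by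
  unfold BarcodeRep.fn
  by_cases h : x ∈ B.supp <;> simp [h]

theorem BarcodeRep.fn_zero (B : BarcodeRep) {x : ℝ} : B.fn x = 0 ↔ x ∉ B.supp := by
  unfold BarcodeRep.fn
  by_cases h : x ∈ B.supp <;> simp [h]

/-- insertion of two interfaces at position `m` -/
def ins (t : ℕ → ℝ) (m : ℕ) (a b : ℝ) : ℕ → ℝ := fun k =>
  if k < m then t k else if k = m then a else if k = m + 1 then b else t (k - 2)

def BarcodeRep.insert (B : BarcodeRep) (m : ℕ) (a b : ℝ) (hm : m ≤ 2 * B.n) (hab : a < b)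
    (ha0 : 0 ≤ a) (hb1 : b ≤ 1)
    (ha : ∀ k < m, B.t k < a) (hb : m < 2 * B.n → b < B.t m) : BarcodeRep where
  n := B.n + 1
  t := ins B.t m a b
  mono := by
    intro k hk l hl hkl
    simp only [mem_Iio] at hk hl
    have hb' : ∀ k, m ≤ k → k < 2 * B.n → b < B.t k := fun k h1 h2 =>
      (hb (by omega)).trans_le (B.le h1 h2)
    unfold ins
    split_ifs with h1 h2 h3 h4 h5 h6 h7 h8 <;> try omega
    all_goals first
      | exact B.lt hkl (by omega)
      | exact ha k h1
      | exact (ha k h1).trans hab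
      | exact ((ha k h1).trans hab).trans (hb' _ (by omega) (by omega))
      | exact hab
      | exact hab.trans (hb' _ (by omega) (by omega))
      | exact hb' _ (by omega) (by omega)
      | exact B.lt (by omega) (by omega)
  left := by
    intro _
    unfold ins
    split_ifs with h1 h2
    · exact B.left (by omega)
    · exact ha0
    · omega
    · omega
  right := by
    intro _
    unfold ins
    split_ifs with h1 h2 h3
    · omega
    · omega
    · exact hb1
    · have := B.right (by omega)
      rwa [show 2 * (B.n + 1) - 1 - 2 = 2 * B.n - 1 by omega]

theorem BarcodeRep.add_bar (B : BarcodeRep) (a b : ℝ) (hab : a < b) (ha0 : 0 ≤ a) (hb1 : b ≤ 1)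
    (h : ∀ x ∈ Icc a b, x ∉ B.supp) :
    IsBarcode (fun x => B.fn x + (Icc a b).indicator (fun _ => (1:ℝ)) x) := by
  classical
  have hex : ∃ p, p = B.n ∨ a < B.t (2*p) := ⟨B.n, Or.inl rfl⟩
  obtain ⟨p, hp, hp'⟩ : ∃ p, (p = B.n ∨ a < B.t (2*p)) ∧ ∀ q < p, q ≠ B.n ∧ B.t (2*q) ≤ a :=
    ⟨Nat.find hex, Nat.find_spec hex, fun q hq => by simpa using Nat.find_min hex hq⟩
  have hpn : p ≤ B.n := by
    by_contra hc
    exact (hp' B.n (by omega)).1 rfl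
  have ho : ∀ q < p, B.t (2*q+1) < a := by
    intro q hq
    by_contra hc
    apply h a ⟨le_rfl, hab.le⟩
    rw [B.mem_supp]
    exact ⟨q, by omega, (hp' q hq).2, by linarith⟩
  have hbt : p < B.n → b < B.t (2*p) := by
    intro hlt
    have h1 : a < B.t (2*p) := by
      rcases hp with hp | hp
      · omega
      · exact hp
    by_contra hc
    apply h (B.t (2*p)) ⟨h1.le, by linarith⟩
    rw [B.mem_supp]
    exact ⟨p, hlt, le_rfl, B.le (by omega) (by omega)⟩
  have hall : ∀ k < 2*p, B.t k < a := by
    intro k hk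
    exact (B.le (show k ≤ 2*(k/2)+1 by omega) (by omega)).trans_lt (ho (k/2) (by omega))
  refine ⟨B.insert (2*p) a b (by omega) hab ha0 hb1 hall (fun h => hbt (by omega)), ?_⟩
  ext x
  have hs : x ∈ (B.insert (2*p) a b (by omega) hab ha0 hb1 hall (fun h => hbt (by omega))).supp ↔
      x ∈ B.supp ∨ x ∈ Icc a b := by
    rw [BarcodeRep.mem_supp, BarcodeRep.mem_supp]
    simp only [BarcodeRep.insert]
    constructor
    · rintro ⟨k, hk, h1, h2⟩
      rcases lt_trichotomy k p with hkp | hkp | hkp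
      · left
        refine ⟨k, by omega, ?_, ?_⟩
        · simpa [ins, show 2*k < 2*p by omega] using h1
        · simpa [ins, show 2*k+1 < 2*p by omega] using h2
      · right
        subst hkp
        simp [ins] at h1 h2
        exact ⟨h1, h2⟩
      · left
        refine ⟨k-1, by omega, ?_, ?_⟩
        · simpa [ins, show ¬ (2*k < 2*p) by omega, show ¬ (2*k = 2*p) by omega,
            show ¬ (2*k = 2*p+1) by omega, show 2*k-2 = 2*(k-1) by omega,
            show ¬ (k < p) by omega, show ¬ (k = p) by omega] using h1
        · simpa [ins, show ¬ (2*k+1 < 2*p) by omega, show ¬ (2*k+1 = 2*p) by omega,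
            show ¬ (2*k+1 = 2*p+1) by omega, show 2*k+1-2 = 2*(k-1)+1 by omega,
            show ¬ (k = p) by omega] using h2
    · rintro (⟨k, hk, h1, h2⟩ | ⟨h1, h2⟩)
      · by_cases hkp : k < p
        · refine ⟨k, by omega, ?_, ?_⟩
          · simpa [ins, show 2*k < 2*p by omega] using h1
          · simpa [ins, show 2*k+1 < 2*p by omega] using h2
        · refine ⟨k+1, by omega, ?_, ?_⟩
          · simp only [ins]
            rw [if_neg (by omega), if_neg (by omega), if_neg (by omega)]
            exact h1
          · simp only [ins]
            rw [if_neg (by omega), if_neg (by omega), if_neg (by omega)]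
            exact h2
      · exact ⟨p, by omega, by simpa [ins] using h1, by simpa [ins] using h2⟩
  unfold BarcodeRep.fn
  by_cases hx : x ∈ Icc a b
  · have := h x hx
    rw [indicator_of_mem hx, indicator_of_notMem this, indicator_of_mem (hs.2 (Or.inr hx))]
    simp
  · by_cases hx2 : x ∈ B.supp
    · rw [indicator_of_notMem hx, indicator_of_mem hx2, indicator_of_mem (hs.2 (Or.inl hx2))]
      simp
    · rw [indicator_of_notMem hx, indicator_of_notMem hx2, indicator_of_notMem]
      · simp
      · rw [hs]; tauto

theorem BarcodeRep.split_bar (B : BarcodeRep) (a₀ a b b₀ : ℝ) (hab : a < b) (ha0 : a₀ < a)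
    (hb1 : b < b₀) (h : ∀ x ∈ Icc a₀ b₀, x ∈ B.supp) :
    IsBarcode (fun x => B.fn x - (Ioo a b).indicator (fun _ => (1:ℝ)) x) := by
  have hsa := h a₀ ⟨le_rfl, by linarith⟩
  have h0 := (B.supp_sub _ hsa).1
  have h1 := (B.supp_sub _ (h b₀ ⟨by linarith, le_rfl⟩)).2
  rw [B.mem_supp] at hsa
  obtain ⟨p, hp, hpa, hpb⟩ := hsa
  have hbt : b < B.t (2*p+1) := by
    refine hb1.trans_le ?_
    by_contra hc
    push Not at hc
    by_cases hpn : p + 1 < B.n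
    · have hg := B.lt (show 2*p+1 < 2*p+2 by omega) (by omega)
      obtain ⟨y, hy1, hy2⟩ := exists_between (lt_min hc hg)
      have := lt_min_iff.1 hy2
      exact B.gap p y hp hy1 (fun _ => this.2) (h y ⟨by linarith, by linarith⟩)
    · exact B.gap p b₀ hp hc (fun h => absurd h hpn) (h b₀ ⟨by linarith, le_rfl⟩)
  have hall : ∀ k < 2*p+1, B.t k < a := by
    intro k hk
    exact (B.le (show k ≤ 2*p by omega) (by omega)).trans_lt (by linarith)
  refine ⟨B.insert (2*p+1) a b (by omega) hab (by linarith) (by linarith) hall (fun h => hbt), ?_⟩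
  ext x
  have hs : x ∈ (B.insert (2*p+1) a b (by omega) hab (by linarith) (by linarith) hall
      (fun h => hbt)).supp ↔ x ∈ B.supp ∧ x ∉ Ioo a b := by
    rw [BarcodeRep.mem_supp, BarcodeRep.mem_supp]
    simp only [BarcodeRep.insert]
    constructor
    · rintro ⟨k, hk, h1, h2⟩
      simp only [ins] at h1 h2
      rcases lt_trichotomy k p with hkp | hkp | hkp
      · rw [if_pos (by omega)] at h1 h2
        refine ⟨⟨k, by omega, h1, h2⟩, ?_⟩
        have := hall (2*k+1) (by omega)
        rintro ⟨h3, h4⟩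
        linarith
      · subst hkp
        rw [if_pos (by omega)] at h1
        rw [if_neg (by omega), if_pos (by omega)] at h2
        refine ⟨⟨k, by omega, h1, by linarith⟩, ?_⟩
        rintro ⟨h3, h4⟩
        linarith
      · by_cases hk1 : k = p + 1
        · subst hk1
          rw [if_neg (by omega), if_neg (by omega), if_pos (by omega)] at h1
          rw [if_neg (by omega), if_neg (by omega), if_neg (by omega)] at h2
          refine ⟨⟨p, by omega, by linarith, h2⟩, ?_⟩
          rintro ⟨h3, h4⟩
          linarith
        · rw [if_neg (by omega), if_neg (by omega), if_neg (by omega)] at h1 h2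
          rw [show 2*k-2 = 2*(k-1) by omega] at h1
          rw [show 2*k+1-2 = 2*(k-1)+1 by omega] at h2
          refine ⟨⟨k-1, by omega, h1, h2⟩, ?_⟩
          have := B.le (show 2*p+1 ≤ 2*(k-1) by omega) (by omega)
          rintro ⟨h3, h4⟩
          linarith
    · rintro ⟨⟨k, hk, h1, h2⟩, h3⟩
      rcases lt_trichotomy k p with hkp | hkp | hkp
      · refine ⟨k, by omega, ?_, ?_⟩
        · simpa only [ins, if_pos (show 2*k < 2*p+1 by omega)] using h1
        · simpa only [ins, if_pos (show 2*k+1 < 2*p+1 by omega)] using h2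
      · subst hkp
        by_cases hx : x ≤ a
        · refine ⟨k, by omega, ?_, ?_⟩
          · simpa only [ins, if_pos (show 2*k < 2*k+1 by omega)] using h1
          · simpa [ins] using hx
        · have hx2 : b ≤ x := by
            by_contra hc
            exact h3 ⟨by linarith, by linarith⟩
          refine ⟨k+1, by omega, ?_, ?_⟩
          · simp only [ins]
            rwa [if_neg (by omega), if_neg (by omega), if_pos (by omega)]
          · simp only [ins]
            rw [if_neg (by omega), if_neg (by omega), if_neg (by omega)]
            exact h2
      · refine ⟨k+1, by omega, ?_, ?_⟩
        · simp only [ins]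
          rw [if_neg (by omega), if_neg (by omega), if_neg (by omega)]
          exact h1
        · simp only [ins]
          rw [if_neg (by omega), if_neg (by omega), if_neg (by omega)]
          exact h2
  unfold BarcodeRep.fn
  by_cases hx : x ∈ Ioo a b
  · have := h x ⟨by linarith [hx.1], by linarith [hx.2]⟩
    rw [indicator_of_mem hx, indicator_of_mem this, indicator_of_notMem]
    · simp
    · rw [hs]; tauto
  · by_cases hx2 : x ∈ B.supp
    · rw [indicator_of_notMem hx, indicator_of_mem hx2, indicator_of_mem (hs.2 ⟨hx2, hx⟩)]
      simp
    · rw [indicator_of_notMem hx, indicator_of_notMem hx2, indicator_of_notMem]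
      · simp
      · rw [hs]; tauto

theorem hat_nonneg (σ : ℝ) (hσ : 0 < σ) (x : ℝ) : 0 ≤ hatKernel σ x := by
  unfold hatKernel
  split_ifs with h
  · have : |x| / σ ≤ 1 := (div_le_one hσ).2 h.le
    exact div_nonneg (by linarith) hσ.le
  · rfl

theorem hat_le (σ : ℝ) (hσ : 0 < σ) (x : ℝ) : hatKernel σ x ≤ 1 / σ := by
  unfold hatKernel
  split_ifs with h
  · have : 0 ≤ |x| / σ := by positivity
    gcongr
    linarith
  · positivity

theorem hat_zero (σ : ℝ) (x : ℝ) (h : x ∉ Icc (-σ) σ) : hatKernel σ x = 0 := by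
  unfold hatKernel
  rw [if_neg]
  intro hc
  have := abs_lt.1 hc
  exact h ⟨this.1.le, this.2.le⟩

theorem hat_even (σ x : ℝ) : hatKernel σ (-x) = hatKernel σ x := by
  simp [hatKernel]

theorem hat_meas (σ : ℝ) : Measurable (hatKernel σ) := by
  unfold hatKernel
  refine Measurable.ite (measurableSet_lt (by fun_prop) (by fun_prop)) (by fun_prop) (by fun_prop)

theorem integrable_box {α : Type*} [MeasurableSpace α] (μ : Measure α) (f : α → ℝ) (C : ℝ) (s : Set α)
    (hf : Measurable f) (hs : μ s < ⊤) (h0 : ∀ x ∉ s, f x = 0) (hC : ∀ x, |f x| ≤ C) :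
    Integrable f μ := by
  rw [← integrableOn_iff_integrable_of_support_subset (s := s)]
  · exact IntegrableOn.of_bound hs hf.aestronglyMeasurable C (Filter.Eventually.of_forall hC)
  · intro x hx
    by_contra hc
    exact hx (h0 x hc)

theorem hat_integrable (σ : ℝ) (hσ : 0 < σ) : Integrable (hatKernel σ) := by
  refine integrable_box volume _ (1/σ) (Icc (-σ) σ) (hat_meas σ) (by simp) (hat_zero σ) ?_
  intro x
  rw [abs_of_nonneg (hat_nonneg σ hσ x)]
  exact hat_le σ hσ x

theorem hat_integral (σ : ℝ) (hσ : 0 < σ) (g : ℝ → ℝ) (hg : Continuous g) :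
    ∫ x, hatKernel σ x * g x = (∫ x in (-σ)..0, (1 + x / σ) / σ * g x) +
      ∫ x in (0:ℝ)..σ, (1 - x / σ) / σ * g x := by
  have e : (fun x => hatKernel σ x * g x) =
      (Ioc (-σ) σ).indicator (fun x => (1 - |x| / σ) / σ * g x) := by
    ext x
    unfold hatKernel
    by_cases h : |x| < σ
    · have := abs_lt.1 h
      rw [if_pos h, indicator_of_mem (show x ∈ Ioc (-σ) σ from ⟨this.1, this.2.le⟩)]
    · rw [if_neg h]
      by_cases hx : x ∈ Ioc (-σ) σ
      · have : x = σ := by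
          by_contra hc
          exact h (abs_lt.2 ⟨hx.1, lt_of_le_of_ne hx.2 hc⟩)
        rw [indicator_of_mem hx, this, abs_of_pos hσ]
        simp [hσ.ne']
      · rw [indicator_of_notMem hx]; simp
  have hc : Continuous (fun x : ℝ => (1 - |x| / σ) / σ * g x) := by fun_prop
  rw [e, integral_indicator measurableSet_Ioc, ← intervalIntegral.integral_of_le (by linarith),
    ← intervalIntegral.integral_add_adjacent_intervals (b := 0) (hc.intervalIntegrable _ _)
      (hc.intervalIntegrable _ _)]
  congr 1
  · apply intervalIntegral.integral_congr
    intro x hx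
    rw [uIcc_of_le (by linarith)] at hx
    simp only
    rw [abs_of_nonpos hx.2]
    ring
  · apply intervalIntegral.integral_congr
    intro x hx
    rw [uIcc_of_le (by linarith)] at hx
    simp only
    rw [abs_of_nonneg hx.1]

theorem poly_integral (a b c0 c1 c2 c3 c4 : ℝ) (f : ℝ → ℝ)
    (hf : ∀ x ∈ uIcc a b, f x = c0 + c1 * x + c2 * x^2 + c3 * x^3 + c4 * x^4) :
    ∫ x in a..b, f x = (c0 * b + c1 * b^2/2 + c2 * b^3/3 + c3 * b^4/4 + c4 * b^5/5) -
      (c0 * a + c1 * a^2/2 + c2 * a^3/3 + c3 * a^4/4 + c4 * a^5/5) := by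
  rw [intervalIntegral.integral_congr (g := fun x => c0 + c1 * x + c2 * x^2 + c3 * x^3 + c4 * x^4) hf]
  apply intervalIntegral.integral_eq_sub_of_hasDerivAt
    (f := fun x => c0 * x + c1 * x^2/2 + c2 * x^3/3 + c3 * x^4/4 + c4 * x^5/5)
  · intro x _
    have h1 := (hasDerivAt_id x).const_mul c0
    have h2 := ((hasDerivAt_pow 2 x).const_mul c1).div_const 2
    have h3 := ((hasDerivAt_pow 3 x).const_mul c2).div_const 3
    have h4 := ((hasDerivAt_pow 4 x).const_mul c3).div_const 4
    have h5 := ((hasDerivAt_pow 5 x).const_mul c4).div_const 5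
    have := (((h1.add h2).add h3).add h4).add h5
    refine HasDerivAt.congr_deriv (this.congr_of_eventuallyEq (Filter.Eventually.of_forall fun y => ?_)) ?_
    · simp
    · norm_num
      ring
  · apply Continuous.intervalIntegrable
    fun_prop

theorem hat_one (σ : ℝ) (hσ : 0 < σ) : ∫ x, hatKernel σ x = 1 := by
  have := hat_integral σ hσ (fun _ => 1) continuous_const
  simp only [mul_one] at this
  rw [this, poly_integral _ _ (1/σ) (1/σ^2) 0 0 0, poly_integral _ _ (1/σ) (-1/σ^2) 0 0 0]
  · field_simp; ring
  · intro x _; field_simp; ring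
  · intro x _; field_simp; ring

theorem inner_nonneg (ρ s : ℝ) (hs : 0 ≤ s) (hsρ : s ≤ ρ) (hρ : 0 < ρ) :
    ∫ x, hatKernel ρ x * |s - x| = ρ/3 + s^2/ρ - s^3/(3*ρ^2) := by
  rw [hat_integral ρ hρ (fun x => |s - x|) (by fun_prop)]
  have hc : Continuous (fun x : ℝ => (1 - x / ρ) / ρ * |s - x|) := by fun_prop
  rw [← intervalIntegral.integral_add_adjacent_intervals (a := 0) (b := s) (c := ρ)
    (hc.intervalIntegrable _ _) (hc.intervalIntegrable _ _)]
  rw [poly_integral (-ρ) 0 (s/ρ) (s/ρ^2 - 1/ρ) (-1/ρ^2) 0 0,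
    poly_integral 0 s (s/ρ) (-s/ρ^2 - 1/ρ) (1/ρ^2) 0 0,
    poly_integral s ρ (-s/ρ) (s/ρ^2 + 1/ρ) (-1/ρ^2) 0 0]
  · field_simp; ring
  · intro x hx
    rw [uIcc_of_le (by linarith)] at hx
    rw [abs_of_nonpos (by linarith [hx.1])]
    field_simp; ring
  · intro x hx
    rw [uIcc_of_le (by linarith)] at hx
    rw [abs_of_nonneg (by linarith [hx.2])]
    field_simp; ring
  · intro x hx
    rw [uIcc_of_le (by linarith)] at hx
    rw [abs_of_nonneg (by linarith [hx.2])]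
    field_simp; ring

theorem inner_abs (ρ s : ℝ) (hsρ : |s| ≤ ρ) (hρ : 0 < ρ) :
    ∫ x, hatKernel ρ x * |s - x| = ρ/3 + |s|^2/ρ - |s|^3/(3*ρ^2) := by
  rcases le_total 0 s with h | h
  · rw [abs_of_nonneg h] at hsρ
    rw [inner_nonneg ρ s h hsρ hρ, abs_of_nonneg h]
  · rw [abs_of_nonpos h] at hsρ ⊢
    rw [← inner_nonneg ρ (-s) (by linarith) hsρ hρ, ← integral_neg_eq_self]
    congr 1
    ext x
    rw [hat_even, ← abs_neg]
    congr 2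
    ring

/-- the mixed first moment -/
theorem moment (ρ σ : ℝ) (hσ : 0 < σ) (h : σ ≤ ρ) :
    ∫ s, hatKernel σ s * ∫ x, hatKernel ρ x * |s - x| =
      (1 / ρ^2 * (-σ^3 + 5 * ρ * σ^2 + 10 * ρ^3)) / 30 := by
  have hρ : 0 < ρ := by linarith
  have e : (fun s => hatKernel σ s * ∫ x, hatKernel ρ x * |s - x|) =
      fun s => hatKernel σ s * (ρ/3 + |s|^2/ρ - |s|^3/(3*ρ^2)) := by
    ext s
    by_cases hs : |s| ≤ ρ
    · rw [inner_abs ρ s hs hρ]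
    · have : hatKernel σ s = 0 := by
        unfold hatKernel
        rw [if_neg (by linarith)]
      rw [this]; simp
  rw [e, hat_integral σ hσ (fun s => ρ/3 + |s|^2/ρ - |s|^3/(3*ρ^2)) (by fun_prop)]
  rw [poly_integral (-σ) 0 (ρ/3/σ) (ρ/3/σ^2) (1/(ρ*σ)) (1/(ρ*σ^2) + 1/(3*ρ^2*σ)) (1/(3*ρ^2*σ^2)),
    poly_integral 0 σ (ρ/3/σ) (-ρ/3/σ^2) (1/(ρ*σ)) (-1/(ρ*σ^2) - 1/(3*ρ^2*σ)) (1/(3*ρ^2*σ^2))]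
  · field_simp; ring
  · intro x hx
    rw [uIcc_of_le (by linarith)] at hx
    rw [abs_of_nonneg hx.1]
    field_simp; ring
  · intro x hx
    rw [uIcc_of_le (by linarith)] at hx
    rw [abs_of_nonpos hx.2]
    field_simp; ring

theorem conv_eq (φ u : ℝ → ℝ) (x : ℝ) : conv φ u x = ∫ s, φ s * u (x - s) := by
  unfold conv
  rw [← integral_sub_left_eq_self (fun s => φ s * u (x - s)) volume x]
  simp

theorem conv_eq_convolution (φ u : ℝ → ℝ) :
    conv φ u = MeasureTheory.convolution φ u (ContinuousLinearMap.mul ℝ ℝ) volume := by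
  ext x
  rw [conv_eq]
  rfl

theorem conv_integrable (φ u : ℝ → ℝ) (hφ : Integrable φ) (hu : Integrable u) :
    Integrable (conv φ u) := by
  rw [conv_eq_convolution]
  exact hφ.integrable_convolution _ hu

theorem conv_integral (φ u : ℝ → ℝ) (hφ : Integrable φ) (hu : Integrable u) :
    ∫ x, conv φ u x = (∫ x, φ x) * ∫ x, u x := by
  rw [conv_eq_convolution]
  exact integral_convolution (L := ContinuousLinearMap.mul ℝ ℝ) hφ hu

theorem conv_integrand (σ : ℝ) (hσ : 0 < σ) (u : ℝ → ℝ) (hm : Measurable u) (h1 : ∀ x, |u x| ≤ 1)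
    (x : ℝ) : Integrable (fun s => hatKernel σ s * u (x - s)) := by
  refine integrable_box volume _ (1/σ) (Icc (-σ) σ) ?_ (by simp) ?_ ?_
  · exact (hat_meas σ).mul (hm.comp (by fun_prop))
  · intro s hs
    rw [hat_zero σ s hs, zero_mul]
  · intro s
    rw [abs_mul, abs_of_nonneg (hat_nonneg σ hσ s)]
    calc _ ≤ 1/σ * 1 := mul_le_mul (hat_le σ hσ s) (h1 _) (abs_nonneg _) (by positivity)
      _ = _ := mul_one _

theorem conv_mono (σ : ℝ) (hσ : 0 < σ) (u v : ℝ → ℝ) (hum : Measurable u) (hu : ∀ x, |u x| ≤ 1)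
    (hvm : Measurable v) (hv : ∀ x, |v x| ≤ 1) (h : ∀ x, u x ≤ v x) (x : ℝ) :
    conv (hatKernel σ) u x ≤ conv (hatKernel σ) v x := by
  rw [conv_eq, conv_eq]
  refine integral_mono (conv_integrand σ hσ u hum hu x) (conv_integrand σ hσ v hvm hv x) ?_
  intro s
  exact mul_le_mul_of_nonneg_left (h _) (hat_nonneg σ hσ s)

theorem conv_add (σ : ℝ) (hσ : 0 < σ) (u v : ℝ → ℝ) (hum : Measurable u) (hu : ∀ x, |u x| ≤ 1)
    (hvm : Measurable v) (hv : ∀ x, |v x| ≤ 1) (x : ℝ) :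
    conv (hatKernel σ) (fun x => u x + v x) x = conv (hatKernel σ) u x + conv (hatKernel σ) v x := by
  rw [conv_eq, conv_eq, conv_eq, ← integral_add (conv_integrand σ hσ u hum hu x)
    (conv_integrand σ hσ v hvm hv x)]
  simp only [mul_add]

theorem conv_sub (σ : ℝ) (hσ : 0 < σ) (u v : ℝ → ℝ) (hum : Measurable u) (hu : ∀ x, |u x| ≤ 1)
    (hvm : Measurable v) (hv : ∀ x, |v x| ≤ 1) (x : ℝ) :
    conv (hatKernel σ) (fun x => u x - v x) x = conv (hatKernel σ) u x - conv (hatKernel σ) v x := by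
  rw [conv_eq, conv_eq, conv_eq, ← integral_sub (conv_integrand σ hσ u hum hu x)
    (conv_integrand σ hσ v hvm hv x)]
  simp only [mul_sub]

theorem conv_one (σ : ℝ) (hσ : 0 < σ) (x : ℝ) : conv (hatKernel σ) (fun _ => 1) x = 1 := by
  rw [conv_eq]
  simp only [mul_one]
  exact hat_one σ hσ

theorem conv_zero (φ : ℝ → ℝ) (x : ℝ) : conv φ (fun _ => 0) x = 0 := by
  simp [conv]

theorem overlap (a b s t : ℝ) :
    b - a - |s - t| ≤ ∫ x, (Icc a b).indicator (fun _ => (1:ℝ)) (x - s) *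
      (Icc a b).indicator (fun _ => (1:ℝ)) (x - t) := by
  have e : (fun x => (Icc a b).indicator (fun _ => (1:ℝ)) (x - s) *
      (Icc a b).indicator (fun _ => (1:ℝ)) (x - t)) =
      (Icc (a + max s t) (b + min s t)).indicator (fun _ => (1:ℝ)) := by
    ext x
    simp only [indicator, mem_Icc]
    rcases le_total s t with h | h
    · rw [max_eq_right h, min_eq_left h]
      split_ifs <;> grind
    · rw [max_eq_left h, min_eq_right h]
      split_ifs <;> grind
  rw [e, integral_indicator measurableSet_Icc]
  simp only [integral_const, MeasurableSet.univ, measureReal_restrict_apply, univ_inter, smul_eq_mul, mul_one]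
  rw [Real.volume_real_Icc]
  refine le_trans (le_of_eq ?_) (le_max_left _ _)
  rcases le_total s t with h | h
  · rw [max_eq_right h, min_eq_left h, abs_of_nonpos (by linarith)]; ring
  · rw [max_eq_left h, min_eq_right h, abs_of_nonneg (by linarith)]; ring

theorem ind_meas (a b : ℝ) : Measurable ((Icc a b).indicator (fun _ => (1:ℝ))) :=
  measurable_const.indicator measurableSet_Icc

theorem ind_abs (s : Set ℝ) (x : ℝ) : |s.indicator (fun _ => (1:ℝ)) x| ≤ 1 := by
  by_cases h : x ∈ s <;> simp [h]

theorem cross (ρ σ a b : ℝ) (hρ : 0 < ρ) (hσ : 0 < σ) :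
    b - a - (∫ s, hatKernel ρ s * ∫ t, hatKernel σ t * |s - t|) ≤
      ∫ x, conv (hatKernel ρ) ((Icc a b).indicator (fun _ => (1:ℝ))) x *
        conv (hatKernel σ) ((Icc a b).indicator (fun _ => (1:ℝ))) x := by
  set w : ℝ → ℝ := (Icc a b).indicator (fun _ => (1:ℝ)) with hw
  have hwm : Measurable w := ind_meas a b
  have hw1 : ∀ x, |w x| ≤ 1 := ind_abs _
  have hmρ := hat_meas ρ
  have hmσ := hat_meas σ
  have e1 : ∀ x, conv (hatKernel ρ) w x * conv (hatKernel σ) w x =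
      ∫ p : ℝ × ℝ, (hatKernel ρ p.1 * w (x - p.1)) * (hatKernel σ p.2 * w (x - p.2)) := by
    intro x
    rw [conv_eq, conv_eq]
    exact (integral_prod_mul (μ := volume) (ν := volume) (fun s => hatKernel ρ s * w (x - s))
      (fun s => hatKernel σ s * w (x - s))).symm
  have hK1 : ∀ s, |hatKernel ρ s| ≤ 1/ρ := fun s => by
    rw [abs_of_nonneg (hat_nonneg ρ hρ s)]; exact hat_le ρ hρ s
  have hK2 : ∀ s, |hatKernel σ s| ≤ 1/σ := fun s => by
    rw [abs_of_nonneg (hat_nonneg σ hσ s)]; exact hat_le σ hσ s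
  have hPR : Integrable (Function.uncurry fun (x : ℝ) (p : ℝ × ℝ) =>
      (hatKernel ρ p.1 * w (x - p.1)) * (hatKernel σ p.2 * w (x - p.2)))
      (volume.prod (volume : Measure (ℝ × ℝ))) := by
    refine integrable_box _ _ (1/ρ * 1 * (1/σ * 1)) (Icc (a - ρ) (b + ρ) ×ˢ (Icc (-ρ) ρ ×ˢ Icc (-σ) σ))
      ?_ ?_ ?_ ?_
    · unfold Function.uncurry
      fun_prop
    · rw [Measure.prod_prod, Measure.volume_eq_prod, Measure.prod_prod]
      simp only [Real.volume_Icc]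
      exact ENNReal.mul_lt_top ENNReal.ofReal_lt_top
        (ENNReal.mul_lt_top ENNReal.ofReal_lt_top ENNReal.ofReal_lt_top)
    · rintro ⟨x, s, t⟩ h
      simp only [Function.uncurry]
      by_cases h1 : s ∈ Icc (-ρ) ρ
      · by_cases h2 : t ∈ Icc (-σ) σ
        · have : w (x - s) = 0 := by
            rw [hw, indicator_of_notMem]
            intro h3
            apply h
            refine ⟨⟨?_, ?_⟩, h1, h2⟩
            · have := h3.1; have := h1.1; simp only; linarith
            · have := h3.2; have := h1.2; simp only; linarith
          rw [this]; ring
        · rw [hat_zero σ t h2]; ring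
      · rw [hat_zero ρ s h1]; ring
    · rintro ⟨x, s, t⟩
      simp only [Function.uncurry, abs_mul]
      have := hK1 s
      have := hK2 t
      have := hw1 (x - s)
      have := hw1 (x - t)
      gcongr
  have hpos : ∀ p : ℝ × ℝ, 0 ≤ hatKernel ρ p.1 * hatKernel σ p.2 := fun p =>
    mul_nonneg (hat_nonneg ρ hρ _) (hat_nonneg σ hσ _)
  have hPL : Integrable (fun p : ℝ × ℝ => hatKernel ρ p.1 * hatKernel σ p.2 * |p.1 - p.2|)
      (volume.prod volume) := by
    refine integrable_box _ _ (1/ρ * (1/σ) * (ρ + σ)) (Icc (-ρ) ρ ×ˢ Icc (-σ) σ) ?_ ?_ ?_ ?_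
    · fun_prop
    · rw [Measure.prod_prod]
      simp only [Real.volume_Icc]
      exact ENNReal.mul_lt_top ENNReal.ofReal_lt_top ENNReal.ofReal_lt_top
    · rintro ⟨s, t⟩ h
      by_cases h1 : s ∈ Icc (-ρ) ρ
      · have h2 : t ∉ Icc (-σ) σ := fun h2 => h ⟨h1, h2⟩
        simp only [hat_zero σ t h2]; ring
      · simp only [hat_zero ρ s h1]; ring
    · rintro ⟨s, t⟩
      by_cases h1 : s ∈ Icc (-ρ) ρ
      · by_cases h2 : t ∈ Icc (-σ) σ
        · have h3 : |s - t| ≤ ρ + σ := by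
            rw [abs_le]
            constructor <;> linarith [h1.1, h1.2, h2.1, h2.2]
          have := hK1 s
          have := hK2 t
          simp only [abs_mul, abs_abs]
          gcongr
        · simp only [hat_zero σ t h2]; simp; positivity
      · simp only [hat_zero ρ s h1]; simp; positivity
  have hPQ : Integrable (fun p : ℝ × ℝ => hatKernel ρ p.1 * hatKernel σ p.2) (volume.prod volume) :=
    (hat_integrable ρ hρ).mul_prod (hat_integrable σ hσ)
  have e3 : ∫ p : ℝ × ℝ, hatKernel ρ p.1 * hatKernel σ p.2 = 1 := by
    have := integral_prod_mul (μ := volume) (ν := volume) (hatKernel ρ) (hatKernel σ)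
    rw [hat_one ρ hρ, hat_one σ hσ, one_mul] at this
    exact this
  have e4 : ∫ p : ℝ × ℝ, hatKernel ρ p.1 * hatKernel σ p.2 * |p.1 - p.2| =
      ∫ s, hatKernel ρ s * ∫ t, hatKernel σ t * |s - t| := by
    rw [Measure.volume_eq_prod, integral_prod _ hPL]
    congr 1
    ext s
    rw [← integral_const_mul]
    simp only [mul_assoc]
  simp_rw [e1]
  rw [integral_integral_swap hPR, ← e4]
  have e5 : b - a - ∫ p : ℝ × ℝ, hatKernel ρ p.1 * hatKernel σ p.2 * |p.1 - p.2| =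
      ∫ p : ℝ × ℝ, ((b - a) * (hatKernel ρ p.1 * hatKernel σ p.2) -
        hatKernel ρ p.1 * hatKernel σ p.2 * |p.1 - p.2|) := by
    rw [Measure.volume_eq_prod] at e3 ⊢
    rw [integral_sub (hPQ.const_mul _) hPL, integral_const_mul, e3, mul_one]
  rw [e5]
  refine integral_mono ((hPQ.const_mul _).sub hPL) hPR.integral_prod_right ?_
  intro p
  have := mul_le_mul_of_nonneg_left (overlap a b p.1 p.2) (hpos p)
  rw [← integral_const_mul] at this
  refine le_trans (le_of_eq (by ring)) (this.trans (le_of_eq ?_))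
  congr 1
  ext x
  ring

theorem fid_eq (g f : ℝ → ℝ) (h : Integrable (fun x => (g x - f x)^2)) :
    fidelity g f = ENNReal.ofReal (∫ x, (g x - f x)^2) := by
  unfold fidelity
  rw [ofReal_integral_eq_lintegral_ofReal h (Filter.Eventually.of_forall fun x => sq_nonneg _)]

theorem mul_int (A B : ℝ → ℝ) (hA : Integrable A) (hB : Integrable B)
    (h0 : ∀ x, 0 ≤ B x) (h1 : ∀ x, B x ≤ 1) : Integrable (fun x => A x * B x) := by
  refine hA.mul_bdd (c := 1) hB.aestronglyMeasurable (Filter.Eventually.of_forall fun x => ?_)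
  rw [Real.norm_eq_abs, abs_of_nonneg (h0 x)]
  exact h1 x

theorem gain (A A' B W S : ℝ → ℝ) (hA : Integrable A) (hA' : Integrable A') (hB : Integrable B)
    (hW : Integrable W) (hS : Integrable S)
    (A0 : ∀ x, 0 ≤ A x) (A1 : ∀ x, A x ≤ 1) (A0' : ∀ x, 0 ≤ A' x) (A1' : ∀ x, A' x ≤ 1)
    (B0 : ∀ x, 0 ≤ B x) (B1 : ∀ x, B x ≤ 1)
    (W0 : ∀ x, 0 ≤ W x) (W1 : ∀ x, W x ≤ 1) (S0 : ∀ x, 0 ≤ S x) (S1 : ∀ x, S x ≤ 1)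
    (h : ∀ x, (A' x - B x)^2 + (W x * W x + 2 * (W x * S x) - 2 * W x) ≤ (A x - B x)^2)
    (c : ℝ) (hc0 : 0 ≤ c)
    (hc : c ≤ (∫ x, W x * W x) + 2 * (∫ x, W x * S x) - 2 * ∫ x, W x) :
    fidelity A' B + ENNReal.ofReal c ≤ fidelity A B ∧ fidelity A' B ≠ ⊤ := by
  have sq : ∀ A : ℝ → ℝ, Integrable A → (∀ x, 0 ≤ A x) → (∀ x, A x ≤ 1) →
      Integrable (fun x => (A x - B x)^2) := by
    intro A hA h0 h1
    have := ((mul_int A A hA hA h0 h1).sub ((mul_int A B hA hB B0 B1).const_mul 2)).add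
      (mul_int B B hB hB B0 B1)
    refine this.congr (Filter.Eventually.of_forall fun x => ?_)
    simp only [Pi.add_apply, Pi.sub_apply]
    ring
  have s1 := sq A hA A0 A1
  have s2 := sq A' hA' A0' A1'
  rw [fid_eq _ _ s1, fid_eq _ _ s2]
  refine ⟨?_, ENNReal.ofReal_ne_top⟩
  rw [← ENNReal.ofReal_add (integral_nonneg fun x => sq_nonneg _) hc0]
  apply ENNReal.ofReal_le_ofReal
  have i1 := mul_int W W hW hW W0 W1
  have i2 := (mul_int W S hW hS S0 S1).const_mul 2
  have i3 := hW.const_mul 2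
  have := integral_mono (s2.add ((i1.add i2).sub i3)) s1 h
  have e := integral_add s2 ((i1.add i2).sub i3)
  have e2 := integral_sub (i1.add i2) i3
  have e3 := integral_add i1 i2
  rw [integral_const_mul] at e2 e3
  simp only [Pi.add_apply, Pi.sub_apply] at this e e2 e3
  linarith

/-- the key estimate -/
theorem key (ρ σ a b c : ℝ) (hρ : 0 < ρ) (hσ : 0 < σ) (hab : a ≤ b)
    (u v z : ℝ → ℝ) (hu : Measurable u) (hv : Measurable v) (hz : Measurable z)
    (iu : Integrable u) (iv : Integrable v) (iz : Integrable z)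
    (u0 : ∀ x, 0 ≤ u x) (u1 : ∀ x, u x ≤ 1) (v0 : ∀ x, 0 ≤ v x) (v1 : ∀ x, v x ≤ 1)
    (z0 : ∀ x, 0 ≤ z x) (z1 : ∀ x, z x ≤ 1)
    (h : ((∀ x, (Icc a b).indicator (fun _ => (1:ℝ)) x ≤ z x) ∧
          (∀ x, u x ≤ 1 - (Icc a b).indicator (fun _ => (1:ℝ)) x) ∧
          (v =ᵐ[volume] fun x => u x + (Icc a b).indicator (fun _ => (1:ℝ)) x)) ∨
        ((∀ x, z x ≤ 1 - (Icc a b).indicator (fun _ => (1:ℝ)) x) ∧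
          (∀ x, (Icc a b).indicator (fun _ => (1:ℝ)) x ≤ u x) ∧
          (v =ᵐ[volume] fun x => u x - (Icc a b).indicator (fun _ => (1:ℝ)) x)))
    (hc0 : 0 ≤ c)
    (hc : c ≤ (b - a) - (∫ s, hatKernel ρ s * ∫ t, hatKernel ρ t * |s - t|) -
      2 * (∫ s, hatKernel ρ s * ∫ t, hatKernel σ t * |s - t|)) :
    fidelity (conv (hatKernel ρ) v) (conv (hatKernel σ) z) + ENNReal.ofReal c ≤
      fidelity (conv (hatKernel ρ) u) (conv (hatKernel σ) z) ∧
    fidelity (conv (hatKernel ρ) v) (conv (hatKernel σ) z) ≠ ⊤ := by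
  set w : ℝ → ℝ := (Icc a b).indicator (fun _ => (1:ℝ)) with hw
  have hwm : Measurable w := ind_meas a b
  have hw1 : ∀ x, |w x| ≤ 1 := ind_abs _
  have w0 : ∀ x, 0 ≤ w x := fun x => indicator_nonneg (fun _ _ => zero_le_one) x
  have w1 : ∀ x, w x ≤ 1 := fun x => (abs_le.1 (hw1 x)).2
  have iw : Integrable w := by
    refine integrable_box volume _ 1 (Icc a b) hwm (by simp) ?_ hw1
    intro x hx
    rw [hw, indicator_of_notMem hx]
  have habs : ∀ f : ℝ → ℝ, (∀ x, 0 ≤ f x) → (∀ x, f x ≤ 1) → ∀ x, |f x| ≤ 1 := fun f h0 h1 x => by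
    rw [abs_of_nonneg (h0 x)]; exact h1 x
  have c0 : ∀ τ, 0 < τ → ∀ f : ℝ → ℝ, Measurable f → (∀ x, 0 ≤ f x) → (∀ x, f x ≤ 1) →
      ∀ x, 0 ≤ conv (hatKernel τ) f x := by
    intro τ hτ f hf h0 h1 x
    rw [← conv_zero (hatKernel τ) x]
    exact conv_mono τ hτ _ _ measurable_const (by simp) hf (habs f h0 h1) h0 x
  have c1 : ∀ τ, 0 < τ → ∀ f : ℝ → ℝ, Measurable f → (∀ x, 0 ≤ f x) → (∀ x, f x ≤ 1) →
      ∀ x, conv (hatKernel τ) f x ≤ 1 := by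
    intro τ hτ f hf h0 h1 x
    rw [← conv_one τ hτ x]
    exact conv_mono τ hτ _ _ hf (habs f h0 h1) measurable_const (by simp) h1 x
  have cw : ∀ τ, 0 < τ → ∀ x, conv (hatKernel τ) (fun x => 1 - w x) x =
      1 - conv (hatKernel τ) w x := by
    intro τ hτ x
    rw [conv_sub τ hτ (fun _ => 1) w measurable_const (by simp) hwm hw1, conv_one τ hτ]
  have hcongr : ∀ f : ℝ → ℝ, v =ᵐ[volume] f → conv (hatKernel ρ) v = conv (hatKernel ρ) f := by
    intro f hf
    ext x
    unfold conv
    apply integral_congr_ae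
    filter_upwards [hf] with y hy
    rw [hy]
  have m1 : Measurable (fun x => 1 - w x) := measurable_const.sub hwm
  have b1 : ∀ x, |1 - w x| ≤ 1 := fun x => by
    rw [abs_le]; constructor <;> linarith [w0 x, w1 x]
  have iφ := hat_integrable ρ hρ
  have iφ' := hat_integrable σ hσ
  refine gain _ _ _ (conv (hatKernel ρ) w) (conv (hatKernel σ) w) (conv_integrable _ _ iφ iu)
    (conv_integrable _ _ iφ iv) (conv_integrable _ _ iφ' iz) (conv_integrable _ _ iφ iw)
    (conv_integrable _ _ iφ' iw) (c0 ρ hρ u hu u0 u1) (c1 ρ hρ u hu u0 u1)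
    (c0 ρ hρ v hv v0 v1) (c1 ρ hρ v hv v0 v1) (c0 σ hσ z hz z0 z1) (c1 σ hσ z hz z0 z1)
    (c0 ρ hρ w hwm w0 w1) (c1 ρ hρ w hwm w0 w1) (c0 σ hσ w hwm w0 w1) (c1 σ hσ w hwm w0 w1)
    ?_ c hc0 ?_
  · intro x
    have W0 := c0 ρ hρ w hwm w0 w1 x
    rcases h with ⟨h1, h2, h3⟩ | ⟨h1, h2, h3⟩
    · have k1 := conv_mono σ hσ w z hwm hw1 hz (habs z z0 z1) h1 x
      have k2 := conv_mono ρ hρ u _ hu (habs u u0 u1) m1 b1 h2 x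
      rw [cw ρ hρ] at k2
      rw [hcongr _ h3, conv_add ρ hρ u w hu (habs u u0 u1) hwm hw1]
      nlinarith
    · have k1 := conv_mono σ hσ z _ hz (habs z z0 z1) m1 b1 h1 x
      have k2 := conv_mono ρ hρ w u hwm hw1 hu (habs u u0 u1) h2 x
      rw [cw σ hσ] at k1
      rw [hcongr _ h3, conv_sub ρ hρ u w hu (habs u u0 u1) hwm hw1]
      nlinarith
  · have x1 := cross ρ ρ a b hρ hρ
    have x2 := cross ρ σ a b hρ hσ
    rw [conv_integral _ _ iφ iw, hat_one ρ hρ, one_mul]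
    have : ∫ x, w x = b - a := by
      rw [hw, integral_indicator measurableSet_Icc]
      simp [Real.volume_real_Icc, hab]
    rw [this]
    linarith

theorem moment_symm (ρ σ : ℝ) (hρ : 0 < ρ) (hσ : 0 < σ) :
    ∫ s, hatKernel ρ s * ∫ t, hatKernel σ t * |s - t| =
    ∫ s, hatKernel σ s * ∫ t, hatKernel ρ t * |s - t| := by
  have hmρ := hat_meas ρ
  have hmσ := hat_meas σ
  have hK1 : ∀ s, |hatKernel ρ s| ≤ 1/ρ := fun s => by
    rw [abs_of_nonneg (hat_nonneg ρ hρ s)]; exact hat_le ρ hρ s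
  have hK2 : ∀ s, |hatKernel σ s| ≤ 1/σ := fun s => by
    rw [abs_of_nonneg (hat_nonneg σ hσ s)]; exact hat_le σ hσ s
  simp only [← integral_const_mul]
  rw [integral_integral_swap]
  · congr 1
    ext s
    congr 1
    ext t
    rw [abs_sub_comm]
    ring
  · refine integrable_box _ _ (1/ρ * ((1/σ) * (ρ + σ))) (Icc (-ρ) ρ ×ˢ Icc (-σ) σ) ?_ ?_ ?_ ?_
    · unfold Function.uncurry
      fun_prop
    · rw [Measure.prod_prod]
      simp only [Real.volume_Icc]
      exact ENNReal.mul_lt_top ENNReal.ofReal_lt_top ENNReal.ofReal_lt_top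
    · rintro ⟨s, t⟩ h
      by_cases h1 : s ∈ Icc (-ρ) ρ
      · have h2 : t ∉ Icc (-σ) σ := fun h2 => h ⟨h1, h2⟩
        simp only [Function.uncurry, hat_zero σ t h2]; ring
      · simp only [Function.uncurry, hat_zero ρ s h1]; ring
    · rintro ⟨s, t⟩
      by_cases h1 : s ∈ Icc (-ρ) ρ
      · by_cases h2 : t ∈ Icc (-σ) σ
        · have h3 : |s - t| ≤ ρ + σ := by
            rw [abs_le]
            constructor <;> linarith [h1.1, h1.2, h2.1, h2.2]
          have := hK1 s
          have := hK2 t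
          simp only [Function.uncurry, abs_mul, abs_abs]
          gcongr
        · simp only [Function.uncurry, hat_zero σ t h2]; simp; positivity
      · simp only [Function.uncurry, hat_zero ρ s h1]; simp; positivity

theorem fn_meas (B : BarcodeRep) : Measurable B.fn := measurable_const.indicator B.meas
theorem fn_nonneg (B : BarcodeRep) (x : ℝ) : 0 ≤ B.fn x := indicator_nonneg (fun _ _ => zero_le_one) x
theorem fn_le (B : BarcodeRep) (x : ℝ) : B.fn x ≤ 1 := (abs_le.1 (ind_abs B.supp x)).2
theorem fn_int (B : BarcodeRep) : Integrable B.fn := by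
  refine integrable_box volume _ 1 (Icc 0 1) (fn_meas B) (by simp) ?_ (ind_abs _)
  intro x hx
  rw [B.fn_zero]
  exact fun h => hx (B.supp_sub x h)

theorem matching (B C : BarcodeRep)
    (h : ∀ k, 1 ≤ k → k < 2 * B.n → ∃ x ∈ Ioo (B.t (k-1)) (B.t k),
      C.fn x = if k % 2 = 1 then 1 else 0) : TV B.fn ≤ TV C.fn := by
  have h' : ∀ k, ∃ x, 1 ≤ k → k < 2 * B.n → x ∈ Ioo (B.t (k-1)) (B.t k) ∧
      C.fn x = if k % 2 = 1 then 1 else 0 := by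
    intro k
    by_cases hk : 1 ≤ k ∧ k < 2 * B.n
    · obtain ⟨x, hx⟩ := h k hk.1 hk.2
      exact ⟨x, fun _ _ => hx⟩
    · exact ⟨0, fun h1 h2 => absurd ⟨h1, h2⟩ hk⟩
  choose X hX using h'
  set y : ℕ → ℝ := fun k => if k = 0 then -1 else if k < 2 * B.n then X k else 2 with hy
  have y0 : y 0 = -1 := by simp [hy]
  have y1 : ∀ k, 1 ≤ k → k < 2 * B.n → y k = X k := by
    intro k h1 h2
    simp only [hy]
    rw [if_neg (by omega), if_pos h2]
  have y2 : ∀ k, 1 ≤ k → 2 * B.n ≤ k → y k = 2 := by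
    intro k h1 h2
    simp only [hy]
    rw [if_neg (by omega), if_neg (by omega)]
  have hmono : Monotone y := by
    apply monotone_nat_of_le_succ
    intro k
    by_cases h1 : k = 0
    · subst h1
      rw [y0]
      by_cases h2 : 0 + 1 < 2 * B.n
      · rw [y1 _ (by omega) h2]
        have e1 := (hX (0+1) (by omega) h2).1.1
        have e2 := B.left (by omega)
        rw [Nat.add_sub_cancel] at e1
        linarith
      · rw [y2 _ (by omega) (by omega)]; norm_num
    · by_cases h2 : k + 1 < 2 * B.n
      · rw [y1 _ (by omega) h2, y1 k (by omega) (by omega)]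
        have e1 := (hX (k+1) (by omega) h2).1.1
        have e2 := (hX k (by omega) (by omega)).1.2
        rw [Nat.add_sub_cancel] at e1
        linarith
      · rw [y2 (k+1) (by omega) (by omega)]
        by_cases h4 : k < 2 * B.n
        · rw [y1 k (by omega) h4]
          have e1 := (hX k (by omega) (by omega)).1.2
          have e2 := B.right (by omega)
          have e3 := B.le (show k ≤ 2 * B.n - 1 by omega) (by omega)
          linarith
        · rw [y2 k (by omega) (by omega)]
  have hval : ∀ k ≤ 2 * B.n, C.fn (y k) = if k % 2 = 1 then 1 else 0 := by
    intro k hk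
    by_cases h1 : k = 0
    · subst h1
      rw [y0, if_neg (by omega), C.fn_zero]
      intro hc
      have := (C.supp_sub _ hc).1
      linarith
    · by_cases h2 : k < 2 * B.n
      · rw [y1 k (by omega) h2, (hX k (by omega) h2).2]
      · rw [y2 k (by omega) (by omega), if_neg (by omega), C.fn_zero]
        intro hc
        have := (C.supp_sub _ hc).2
        linarith
  refine B.TV_le.trans ?_
  have hs := eVariationOn.sum_le (f := C.fn) (s := univ) (n := 2 * B.n) hmono (fun _ => mem_univ _)
  refine le_trans (le_of_eq ?_) hs
  rw [Finset.sum_congr rfl (g := fun _ => (1:ENNReal))]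
  · simp
  · intro k hk
    rw [Finset.mem_range] at hk
    rw [hval k (by omega), hval (k+1) (by omega)]
    rcases Nat.mod_two_eq_zero_or_one k with hm | hm
    · rw [if_pos (by omega), if_neg (by omega)]
      simp [edist_dist]
    · rw [if_neg (by omega), if_pos (by omega)]
      simp [edist_dist]

theorem inBij_modify (u v : ℝ → ℝ) (i j a b : ℝ) (ha : 0 < a) (hb : b < 1) (hab : a < b)
    (h : InBij u i j) (hv : ∀ x ∉ Icc a b, v x = u x) : InBij v i j := by
  obtain ⟨x₁, x₂, h1, h2, h3, h4, h5⟩ := h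
  refine ⟨min x₁ (a/2), max x₂ ((b+1)/2), lt_min h1 (by linarith), ?_, max_lt h3 (by linarith), ?_, ?_⟩
  · exact (min_le_left _ _).trans (h2.trans (le_max_left _ _))
  · intro x hx
    have k1 := hx.2.trans (min_le_left _ _)
    have k2 := hx.2.trans (min_le_right _ _)
    rw [hv x (fun hc => by linarith [hc.1]), h4 x ⟨hx.1, k1⟩]
  · intro x hx
    have k1 := (le_max_left _ _).trans hx.1
    have k2 := (le_max_right _ _).trans hx.1
    rw [hv x (fun hc => by linarith [hc.2]), h5 x ⟨k1, hx.2⟩]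

theorem contra (lam c : ℝ) (hlam : 0 < lam) (hc : 2 / lam < c) (Tu Tv fu fv : ENNReal) (hT : Tu ≠ ⊤)
    (hfv : fv ≠ ⊤) (h1 : Tv ≤ Tu + 2) (h2 : fv + ENNReal.ofReal c ≤ fu)
    (h3 : Tu + ENNReal.ofReal lam * fu ≤ Tv + ENNReal.ofReal lam * fv) : False := by
  have k : Tu + ENNReal.ofReal lam * (fv + ENNReal.ofReal c) ≤ Tu + 2 + ENNReal.ofReal lam * fv :=
    calc _ ≤ Tu + ENNReal.ofReal lam * fu := by gcongr
      _ ≤ _ := h3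
      _ ≤ _ := by gcongr
  have hcl : 2 < lam * c := by
    rw [div_lt_iff₀ hlam] at hc; linarith
  rw [mul_add, ← ENNReal.ofReal_mul hlam.le, add_assoc,
    add_comm 2, ENNReal.add_le_add_iff_left hT, ENNReal.add_le_add_iff_left
      (ENNReal.mul_ne_top ENNReal.ofReal_ne_top hfv)] at k
  have : ENNReal.ofReal (lam * c) ≤ ENNReal.ofReal 2 := by simpa using k
  rw [ENNReal.ofReal_le_ofReal_iff (by norm_num)] at this
  linarith

/-- Lemma 8: for hat kernels with `ρ, σ ≤ ω/2`,
`z ∈ ℬ_ω^{ij}` and `λ` satisfying `2/λ + (1/15)(7ρ + f(ρ,σ)) < ω`, any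
minimiser `u` of `F₃` over `ℬ^{ij}` satisfies `∫|u'| ≥ ∫|z'|`. -/
theorem statement12 (σ ρ ω lam : ℝ) (hσ : 0 < σ) (hρ : 0 < ρ)
    (hσω : σ ≤ ω / 2) (hρω : ρ ≤ ω / 2) (hω : 0 < ω)
    (i j : ℝ) (hi : i = 0 ∨ i = 1) (hj : j = 0 ∨ j = 1)
    (z : ℝ → ℝ) (hz : IsBarcodeW z ω) (hzij : InBij z i j) (hlam : 0 < lam)
    (hcond : 2 / lam + 1 / 15 *
      (7 * ρ + (if σ ≤ ρ then 1 / ρ^2 * (-σ^3 + 5 * ρ * σ^2 + 10 * ρ^3)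
                else 1 / σ^2 * (-ρ^3 + 5 * σ * ρ^2 + 10 * σ^3))) < ω)
    (u : ℝ → ℝ) (hu : IsBarcode u) (huij : InBij u i j)
    (hmin : ∀ v : ℝ → ℝ, IsBarcode v → InBij v i j →
      Fker lam (hatKernel ρ) (conv (hatKernel σ) z) u ≤
        Fker lam (hatKernel ρ) (conv (hatKernel σ) z) v) :
    TV z ≤ TV u := by
  obtain ⟨B, rfl, hw1, hw2, -, -⟩ := hz
  obtain ⟨C, rfl⟩ := hu
  by_contra hcon
  have hm := mt (matching B C) hcon
  push Not at hm
  obtain ⟨k, hk1, hk2, hbad⟩ := hm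
  -- moments
  set M1 := ∫ s, hatKernel ρ s * ∫ t, hatKernel ρ t * |s - t| with hM1
  set M2 := ∫ s, hatKernel ρ s * ∫ t, hatKernel σ t * |s - t| with hM2
  have eM1 : M1 = 7 * ρ / 15 := by
    rw [hM1, moment ρ ρ hρ le_rfl]
    field_simp
    ring
  have hcond' : 2 / lam + M1 + 2 * M2 < ω := by
    rw [eM1]
    split_ifs at hcond with h
    · rw [hM2, moment_symm ρ σ hρ hσ, moment ρ σ hσ h]
      linarith
    · rw [hM2, moment σ ρ hρ (by linarith)]
      linarith
  have hl2 : 0 < 2 / lam := by positivity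
  set ε := min (ω / 8) ((ω - (2 / lam + M1 + 2 * M2)) / 4) with hε
  have hε0 : 0 < ε := lt_min (by linarith) (by linarith)
  have hε1 : ε ≤ ω / 8 := min_le_left _ _
  have hε2 : ε ≤ (ω - (2 / lam + M1 + 2 * M2)) / 4 := min_le_right _ _
  -- width
  have hwid : ω ≤ B.t k - B.t (k-1) := by
    rcases Nat.even_or_odd' k with ⟨p, hp | hp⟩
    · have := hw2 (p-1) (by omega)
      rw [show 2*(p-1)+2 = k by omega, show 2*(p-1)+1 = k-1 by omega] at this
      exact this
    · have := hw1 p (by omega)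
      rw [← hp, show 2*p = k-1 by omega] at this
      exact this
  have ht0 : 0 ≤ B.t (k-1) := (B.left (by omega)).trans (B.le (by omega) (by omega))
  have ht1 : B.t k ≤ 1 := (B.le (by omega) (by omega)).trans (B.right (by omega))
  set a := B.t (k-1) + ε with ha
  set b := B.t k - ε with hb
  have hab : a < b := by linarith
  have hTu : TV C.fn ≠ ⊤ := ne_top_of_le_ne_top (by finiteness) C.TV_le
  have hsub : ∀ x ∈ Icc a b, x ∈ Ioo (B.t (k-1)) (B.t k) := fun x hx =>
    ⟨by linarith [hx.1], by linarith [hx.2]⟩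
  set c := (b - a) - M1 - 2 * M2 with hc
  have hcc : 2 / lam < c := by linarith
  rcases Nat.even_or_odd' k with ⟨p, hp | hp⟩
  · -- space of z, u = 1
    have hz0 : ∀ x ∈ Icc a b, B.fn x = 0 := by
      intro x hx
      have := hsub x hx
      rw [B.fn_zero]
      apply B.gap (p-1) x (by omega)
      · rw [show 2*(p-1)+1 = k-1 by omega]; exact this.1
      · intro _
        rw [show 2*(p-1)+2 = k by omega]; exact this.2
    have hu1 : ∀ x ∈ Ioo (B.t (k-1)) (B.t k), x ∈ C.supp := by
      intro x hx
      have := hbad x hx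
      rw [if_neg (by omega)] at this
      by_contra hxc
      exact this (C.fn_zero.2 hxc)
    have hvb : IsBarcode (fun x => C.fn x - (Ioo a b).indicator (fun _ => (1:ℝ)) x) :=
      C.split_bar (a - ε/2) a b (b + ε/2) hab (by linarith) (by linarith)
        (fun x hx => hu1 x ⟨by linarith [hx.1], by linarith [hx.2]⟩)
    have hvij := inBij_modify C.fn (i := i) (j := j) (a := a) (b := b) (ha := by linarith) (hb := by linarith) (hab := hab) (h := huij)
      (v := fun x => C.fn x - (Ioo a b).indicator (fun _ => (1:ℝ)) x) (hv := by
        intro x hx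
        have : x ∉ Ioo a b := fun h => hx ⟨h.1.le, h.2.le⟩
        simp [this])
    have hF := hmin _ hvb hvij
    have hTV : TV (fun x => C.fn x - (Ioo a b).indicator (fun _ => (1:ℝ)) x) ≤ TV C.fn + 2 :=
      (TV_sub_le _ _).trans (add_le_add le_rfl (TV_Ioo a b hab))
    obtain ⟨D, hD⟩ := hvb
    rw [hD] at hF hTV
    have hk := key ρ σ a b c hρ hσ hab.le C.fn D.fn B.fn (fn_meas _) (fn_meas _) (fn_meas _)
      (fn_int _) (fn_int _) (fn_int _) (fn_nonneg _) (fn_le _) (fn_nonneg _) (fn_le _)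
      (fn_nonneg _) (fn_le _) (Or.inr ⟨?_, ?_, ?_⟩) (by linarith) le_rfl
    · exact contra lam c hlam hcc _ _ _ _ hTu hk.2 hTV hk.1 hF
    · intro x
      by_cases hx : x ∈ Icc a b
      · rw [indicator_of_mem hx, hz0 x hx]; simp
      · rw [indicator_of_notMem hx]; simpa using fn_le B x
    · intro x
      by_cases hx : x ∈ Icc a b
      · rw [indicator_of_mem hx, C.fn_one.2 (hu1 x (hsub x hx))]
      · rw [indicator_of_notMem hx]; exact fn_nonneg C x
    · rw [← hD]
      have : (Ioo a b).indicator (fun _ => (1:ℝ)) =ᵐ[volume] (Icc a b).indicator (fun _ => (1:ℝ)) :=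
        indicator_ae_eq_of_ae_eq_set Ioo_ae_eq_Icc
      filter_upwards [this] with x hx
      rw [hx]
  · -- bar of z, u = 0
    have hz1 : ∀ x ∈ Icc a b, B.fn x = 1 := by
      intro x hx
      have := hsub x hx
      rw [B.fn_one, B.mem_supp]
      refine ⟨p, by omega, ?_, ?_⟩
      · rw [show 2*p = k-1 by omega]; exact this.1.le
      · rw [← hp]; exact this.2.le
    have hu0 : ∀ x ∈ Icc a b, x ∉ C.supp := by
      intro x hx hxc
      have := hbad x (hsub x hx)
      rw [if_pos (by omega)] at this
      exact this (C.fn_one.2 hxc)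
    have hvb : IsBarcode (fun x => C.fn x + (Icc a b).indicator (fun _ => (1:ℝ)) x) :=
      C.add_bar a b hab (by linarith) (by linarith) hu0
    have hvij := inBij_modify C.fn (i := i) (j := j) (a := a) (b := b) (ha := by linarith) (hb := by linarith) (hab := hab) (h := huij)
      (v := fun x => C.fn x + (Icc a b).indicator (fun _ => (1:ℝ)) x) (hv := by
        intro x hx
        simp only [indicator_of_notMem hx, add_zero])
    have hF := hmin _ hvb hvij
    have hTV : TV (fun x => C.fn x + (Icc a b).indicator (fun _ => (1:ℝ)) x) ≤ TV C.fn + 2 :=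
      (TV_add_le _ _).trans (add_le_add le_rfl (TV_Icc a b hab.le))
    obtain ⟨D, hD⟩ := hvb
    rw [hD] at hF hTV
    have hk := key ρ σ a b c hρ hσ hab.le C.fn D.fn B.fn (fn_meas _) (fn_meas _) (fn_meas _)
      (fn_int _) (fn_int _) (fn_int _) (fn_nonneg _) (fn_le _) (fn_nonneg _) (fn_le _)
      (fn_nonneg _) (fn_le _) (Or.inl ⟨?_, ?_, ?_⟩) (by linarith) le_rfl
    · exact contra lam c hlam hcc _ _ _ _ hTu hk.2 hTV hk.1 hF
    · intro x
      by_cases hx : x ∈ Icc a b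
      · rw [indicator_of_mem hx, hz1 x hx]
      · rw [indicator_of_notMem hx]; exact fn_nonneg B x
    · intro x
      by_cases hx : x ∈ Icc a b
      · rw [indicator_of_mem hx, C.fn_zero.2 (hu0 x hx)]; simp
      · rw [indicator_of_notMem hx]; simpa using fn_le C x
    · rw [← hD]

end
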